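/- arXiv:0810.4859 — 2 statements merged into one kernel-verified Lean document; each statement's English description precedes it below -/
import Mathlib

section
/- Let u ∈ W and let s_i be a simple reflection with fundamental weight w_i. Writing d_{s_i, u} for the sum over all reduced decompositions of s_i induced from a fixed reduced decomposition u = σ_{β_1}⋯σ_{β_m} of the products γ_{j} = σ_{β_1}⋯σ_{β_{j-1}}(β_j) over positions j where σ_{β_j} = s_i appears as a one-term subword whose product is s_i, one has d_{s_i, u} = w_i - u(w_i). Equivalently: the sum of γ_j over all indices j with σ_{γ_j} of the form giving subword s_i equals w_i - u(w_i). -/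
/- Common framework: a based (crystallographic) root system datum, its Weyl group,
   lengths, the affine Weyl group `W ⋉ Q^∨` realized as a semidirect product, affine
   simple reflections, affine length, Bruhat order, and the action on affine roots. -/

open Module

noncomputable section

/-- Datum of a based root system: a root space `V` over `ℚ`, simple roots `α i ∈ V`
and simple coroots `αv i` in the dual space (the pairing `⟨λ, γ⟩` is evaluation
`λ γ`), satisfying `⟨α_i^∨, α_i⟩ = 2` and integrality of the Cartan numbers. -/
structure BasedRootDatum (I : Type) [Fintype I] [DecidableEq I] where
  V : Type
  [acg : AddCommGroup V]
  [mod : Module ℚ V]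
  α : I → V
  αv : I → Module.Dual ℚ V
  pairing_self : ∀ i, αv i (α i) = 2
  cartan_int : ∀ i j, ∃ z : ℤ, αv i (α j) = (z : ℚ)

attribute [instance] BasedRootDatum.acg BasedRootDatum.mod

namespace BasedRootDatum

variable {I : Type} [Fintype I] [DecidableEq I] (D : BasedRootDatum I)

/-- the simple reflection `σ_i` as a linear automorphism of `V` -/
def s (i : I) : D.V ≃ₗ[ℚ] D.V := Module.reflection (D.pairing_self i)

/-- the Weyl group `W`, generated by the simple reflections -/
def weylGroup : Subgroup (D.V ≃ₗ[ℚ] D.V) := Subgroup.closure (Set.range D.s)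

/-- the set of roots: the Weyl orbit of the simple roots -/
def roots : Set D.V := {v | ∃ i, ∃ w ∈ D.weylGroup, v = w (D.α i)}

/-- positive roots: roots which are nonnegative integral combinations of simple roots -/
def posRoots : Set D.V := {v ∈ D.roots | ∃ c : I → ℕ, v = ∑ i, (c i : ℚ) • D.α i}

/-- `σ` is the reflection `σ_γ` in the root `γ`: `σ_γ = w σ_i w⁻¹` whenever `γ = w(α_i)` -/
def IsReflectionOf (σ : D.V ≃ₗ[ℚ] D.V) (γ : D.V) : Prop :=
  ∃ i, ∃ w ∈ D.weylGroup, γ = w (D.α i) ∧ σ = w * D.s i * w⁻¹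

/-- `cγ` is the coroot `γ^∨` of the root `γ`: `γ^∨ = w(α_i^∨)` whenever `γ = w(α_i)` -/
def IsCorootOf (cγ : Module.Dual ℚ D.V) (γ : D.V) : Prop :=
  ∃ i, ∃ w, w ∈ D.weylGroup ∧ γ = w (D.α i) ∧ ∀ v : D.V, cγ v = D.αv i (w⁻¹ v)

/-- the length of `w ∈ W` as a word in the simple reflections -/
def len (w : D.V ≃ₗ[ℚ] D.V) : ℕ :=
  sInf {n | ∃ l : List I, l.length = n ∧ (l.map D.s).prod = w}

/-- `w₀` is the longest element of the Weyl group: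
`ℓ(w₀ w) = ℓ(w₀) - ℓ(w)` for all `w ∈ W` -/
def IsLongest (w₀ : D.V ≃ₗ[ℚ] D.V) : Prop :=
  w₀ ∈ D.weylGroup ∧ ∀ w ∈ D.weylGroup, D.len (w₀ * w) + D.len w = D.len w₀

/-- `θ` is the highest root: a positive root such that `θ - β` is a nonnegative
combination of simple roots for every positive root `β` -/
def IsHighestRoot (θ : D.V) : Prop :=
  θ ∈ D.posRoots ∧ ∀ β ∈ D.posRoots, ∃ c : I → ℕ, θ - β = ∑ i, (c i : ℚ) • D.α i

/-- the coroot lattice `Q^∨` -/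
def corootLattice : AddSubgroup (Module.Dual ℚ D.V) :=
  AddSubgroup.closure (Set.range D.αv)

/-- the contragredient action of the Weyl group on the dual space:
`w(λ) = λ ∘ w⁻¹`, turned into automorphisms of the (multiplicatively written)
additive group of the dual space. -/
def dualAct : (D.V ≃ₗ[ℚ] D.V) →* MulAut (Multiplicative (Module.Dual ℚ D.V)) where
  toFun w :=
    { toFun := fun f => Multiplicative.ofAdd
        ((Multiplicative.toAdd f).comp ((w⁻¹ : D.V ≃ₗ[ℚ] D.V) : D.V →ₗ[ℚ] D.V))
      invFun := fun f => Multiplicative.ofAdd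
        ((Multiplicative.toAdd f).comp ((w : D.V ≃ₗ[ℚ] D.V) : D.V →ₗ[ℚ] D.V))
      left_inv := fun f => by
        have h : ((Multiplicative.toAdd f).comp
            ((w⁻¹ : D.V ≃ₗ[ℚ] D.V) : D.V →ₗ[ℚ] D.V)).comp
            ((w : D.V ≃ₗ[ℚ] D.V) : D.V →ₗ[ℚ] D.V) = Multiplicative.toAdd f := by
          ext v
          exact congrArg _ (w.symm_apply_apply v)
        exact congrArg Multiplicative.ofAdd h
      right_inv := fun f => by
        have h : ((Multiplicative.toAdd f).comp
            ((w : D.V ≃ₗ[ℚ] D.V) : D.V →ₗ[ℚ] D.V)).comp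
            ((w⁻¹ : D.V ≃ₗ[ℚ] D.V) : D.V →ₗ[ℚ] D.V) = Multiplicative.toAdd f := by
          ext v
          exact congrArg _ (w.apply_symm_apply v)
        exact congrArg Multiplicative.ofAdd h
      map_mul' := fun f g => by
        simp only [toAdd_mul, LinearMap.add_comp, ofAdd_add] }
  map_one' := by
    refine MulEquiv.ext fun f => ?_
    have h : (Multiplicative.toAdd f).comp
        (((1 : D.V ≃ₗ[ℚ] D.V)⁻¹ : D.V ≃ₗ[ℚ] D.V) : D.V →ₗ[ℚ] D.V)
        = Multiplicative.toAdd f := by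
      ext v; simp
    exact congrArg Multiplicative.ofAdd h
  map_mul' := fun a b => by
    refine MulEquiv.ext fun f => ?_
    have h : (Multiplicative.toAdd f).comp
        (((a * b)⁻¹ : D.V ≃ₗ[ℚ] D.V) : D.V →ₗ[ℚ] D.V)
        = ((Multiplicative.toAdd f).comp ((b⁻¹ : D.V ≃ₗ[ℚ] D.V) : D.V →ₗ[ℚ] D.V)).comp
          ((a⁻¹ : D.V ≃ₗ[ℚ] D.V) : D.V →ₗ[ℚ] D.V) := by
      ext v; rw [mul_inv_rev]; rfl
    exact congrArg Multiplicative.ofAdd h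

/-- the affine Weyl group ambient group: the semidirect product of the
(translations by the) dual space with the linear automorphism group of `V`;
the affine Weyl group `W_af = W ⋉ Q^∨` sits inside it as the subgroup generated
by the affine simple reflections. -/
abbrev Aff : Type := (Multiplicative (Module.Dual ℚ D.V)) ⋊[D.dualAct] (D.V ≃ₗ[ℚ] D.V)

/-- the translation element `t_λ` -/
def t (lam : Module.Dual ℚ D.V) : D.Aff := SemidirectProduct.inl (Multiplicative.ofAdd lam)

/-- the embedding of the finite Weyl group -/
def emb : (D.V ≃ₗ[ℚ] D.V) →* D.Aff := SemidirectProduct.inr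

/-- the affine simple reflections, given the reflection `σθ = σ_θ` in the highest
root `θ` and the coroot `θv = θ^∨`: `affS none = σ₀ = σ_θ t_{-θ^∨}` and
`affS (some i) = σ_i`. -/
def affS (σθ : D.V ≃ₗ[ℚ] D.V) (θv : Module.Dual ℚ D.V) : Option I → D.Aff
  | none => D.emb σθ * D.t (-θv)
  | some i => D.emb (D.s i)

/-- length in the affine Weyl group, as a word in the affine simple reflections -/
def afflen (σθ : D.V ≃ₗ[ℚ] D.V) (θv : Module.Dual ℚ D.V) (x : D.Aff) : ℕ :=
  sInf {n | ∃ l : List (Option I), l.length = n ∧ (l.map (D.affS σθ θv)).prod = x}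

/-- Bruhat order on the affine Weyl group: reflexive-transitive closure of the
covering relation `x → σ_γ x` with `ℓ(σ_γ x) = ℓ(x) + 1`. -/
def bruhatLE (σθ : D.V ≃ₗ[ℚ] D.V) (θv : Module.Dual ℚ D.V) : D.Aff → D.Aff → Prop :=
  Relation.ReflTransGen (fun x y =>
    (∃ z : D.Aff, ∃ a : Option I, y = (z * D.affS σθ θv a * z⁻¹) * x) ∧
    D.afflen σθ θv y = D.afflen σθ θv x + 1)

/-- `x` is a minimal-length representative of its coset `x W` in `W_af / W` -/
def IsMinRep (σθ : D.V ≃ₗ[ℚ] D.V) (θv : Module.Dual ℚ D.V) (x : D.Aff) : Prop :=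
  ∀ w ∈ D.weylGroup, D.afflen σθ θv x ≤ D.afflen σθ θv (x * D.emb w)

/-- the action of the affine Weyl group on the affine root space `V ⊕ ℚδ`,
where the pair `(γ, m)` encodes the affine root `γ + mδ`:
`w t_λ (γ + mδ) = w(γ) + (m - ⟨λ, γ⟩)δ`. -/
def affAct (x : D.Aff) (p : D.V × ℚ) : D.V × ℚ :=
  (x.right p.1, p.2 - (Multiplicative.toAdd x.left) (x.right p.1))

/-- positive real affine roots: `γ + mδ` with `γ ∈ R`, `m ∈ ℤ⁺`, or `γ ∈ R⁺`, `m = 0` -/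
def affPosRoots : Set (D.V × ℚ) :=
  {p | (p.1 ∈ D.roots ∧ 0 < p.2 ∧ ∃ m : ℤ, p.2 = (m : ℚ)) ∨ (p.1 ∈ D.posRoots ∧ p.2 = 0)}

/-- the affine simple root attached to an affine simple reflection:
`α₀ = δ - θ` for the affine node, `α_i` for the finite nodes -/
def affRootOf (θ : D.V) : Option I → D.V × ℚ
  | none => (-θ, 1)
  | some i => (D.α i, 0)

end BasedRootDatum

open BasedRootDatum

variable {I : Type} [Fintype I] [DecidableEq I]

namespace BasedRootDatum

theorem s_apply (D : BasedRootDatum I) (i : I) (v : D.V) :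
    D.s i v = v - D.αv i v • D.α i :=
  Module.reflection_apply v (D.pairing_self i)

theorem α_ne_zero (D : BasedRootDatum I) (i : I) : D.α i ≠ 0 := by
  intro h
  simpa [h] using D.pairing_self i

theorem s_injective_of_fundamental_weights (D : BasedRootDatum I) (ϖ : I → D.V)
    (hϖ : ∀ i j, D.αv j (ϖ i) = if i = j then 1 else 0) : Function.Injective D.s := by
  intro j i h
  by_contra hne
  have key := congrArg (fun f : D.V ≃ₗ[ℚ] D.V => f (ϖ i)) h
  simp only [s_apply, hϖ, if_neg (Ne.symm hne)] at key
  exact D.α_ne_zero i (by simpa [eq_comm (a := ϖ i)] using key)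

/-- Telescoping along a word: `v - σ_{β_1} ⋯ σ_{β_m} v = ∑ ⟨β_j^∨, v⟩ γ_j`. -/
theorem sum_pairing_smul_eq_sub_prod_apply (D : BasedRootDatum I) (v : D.V) (l : List I) :
    ∑ k : Fin l.length,
        D.αv (l.get k) v • (((l.take (k : ℕ)).map D.s).prod) (D.α (l.get k))
      = v - (l.map D.s).prod v := by
  induction l with
  | nil => simp
  | cons a t ih =>
    have ih' := congrArg (D.s a) ih
    simp only [List.get_eq_getElem, map_sum, map_smul, map_sub, s_apply D a v] at ih'
    simp only [List.length_cons, Fin.sum_univ_succ, List.get_eq_getElem, List.getElem_cons_zero,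
      List.getElem_cons_succ, Fin.val_zero, Fin.val_succ, List.take_zero, List.take_succ_cons,
      List.map_nil, List.map_cons, List.prod_nil, List.prod_cons, LinearEquiv.mul_apply]
    rw [ih', LinearEquiv.coe_one, id_eq]
    abel

end BasedRootDatum

open Classical in
/-- `d_{s_i, u} = w_i - u(w_i)`: for a reduced word `u = σ_{β_1} ⋯ σ_{β_m}`,
the sum of `γ_j = σ_{β_1} ⋯ σ_{β_{j-1}}(β_j)` over the positions `j` with `σ_{β_j} = s_i`
equals `ϖ_i - u(ϖ_i)`, where `ϖ_i` is the fundamental weight dual to `α_i^∨`. -/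
theorem d_simple_eq_weight_sub (D : BasedRootDatum I)
    (ϖ : I → D.V) (hϖ : ∀ i j, D.αv j (ϖ i) = if i = j then 1 else 0)
    (u : D.V ≃ₗ[ℚ] D.V) (hu : u ∈ D.weylGroup) (i : I)
    (l : List I) (hprod : (l.map D.s).prod = u) (hred : l.length = D.len u) :
    ∑ k : Fin l.length,
        (if D.s (l.get k) = D.s i
          then (((l.take (k : ℕ)).map D.s).prod) (D.α (l.get k)) else 0)
      = ϖ i - u (ϖ i) := by
  rw [← hprod, ← sum_pairing_smul_eq_sub_prod_apply]
  refine Finset.sum_congr rfl fun k _ => ?_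
  rw [hϖ, ite_smul, one_smul, zero_smul]
  exact if_congr ((D.s_injective_of_fundamental_weights ϖ hϖ).eq_iff.trans eq_comm) rfl rfl
end
end

section
/- For any u, v ∈ W with u = σ_{β_1}⋯σ_{β_k} reduced (β_j simple), the polynomial d_{v,u} (sum over induced reduced subwords of v of the products of the roots γ_j = σ_{β_1}⋯σ_{β_{j-1}}(β_j)) satisfies d_{v,u} = (-1)^{ℓ(v)} u(d_{v^{-1}, u^{-1}}), where d_{v^{-1},u^{-1}} is defined using the reversed reduced word u^{-1} = σ_{β_k}⋯σ_{β_1}. -/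
/- Common framework: a based (crystallographic) root system datum, its Weyl group,
   lengths, the affine Weyl group `W ⋉ Q^∨` realized as a semidirect product, affine
   simple reflections, affine length, Bruhat order, and the action on affine roots. -/

open Module

noncomputable section

open BasedRootDatum

variable {I : Type} [Fintype I] [DecidableEq I]

open Classical in
/-- the polynomial `d_{v,u}` computed from the reduced word `l` of `u`: the sum over all
subsequences of `l` which are reduced words for `v` of the products of the corresponding
roots `γ_j = σ_{β_1} ⋯ σ_{β_{j-1}}(β_j)`, viewed in a commutative `ℚ`-algebra `A`
via a linear map `ι` from the root space. -/
noncomputable def BasedRootDatum.dPoly (D : BasedRootDatum I)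
    {A : Type} [CommRing A] [Algebra ℚ A] (ι : D.V →ₗ[ℚ] A)
    (l : List I) (v : D.V ≃ₗ[ℚ] D.V) : A :=
  ∑ S : Finset (Fin l.length),
    if (((S.sort (· ≤ ·)).map (fun k => D.s (l.get k))).prod = v ∧ S.card = D.len v)
    then ∏ k ∈ S, ι ((((l.take (k : ℕ)).map D.s).prod) (D.α (l.get k)))
    else 0

namespace BasedRootDatum

variable (D : BasedRootDatum I)

theorem s_mul_self (i : I) : D.s i * D.s i = 1 :=
  LinearEquiv.ext fun x => Module.involutive_reflection (D.pairing_self i) x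

theorem s_inv (i : I) : (D.s i)⁻¹ = D.s i :=
  inv_eq_of_mul_eq_one_left (D.s_mul_self i)

theorem s_apply_simpleRoot (i : I) : D.s i (D.α i) = -D.α i :=
  Module.reflection_apply_self (D.pairing_self i)

theorem prod_map_s_reverse {X : Type*} (f : X → I) (l : List X) :
    (l.reverse.map fun x => D.s (f x)).prod = (l.map fun x => D.s (f x)).prod⁻¹ := by
  rw [List.prod_inv_reverse, List.map_reverse, List.map_map]
  simp only [Function.comp_def, s_inv]

theorem len_inv (w : D.V ≃ₗ[ℚ] D.V) : D.len w⁻¹ = D.len w := by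
  have key : ∀ (w : D.V ≃ₗ[ℚ] D.V) (n : ℕ),
      (∃ l : List I, l.length = n ∧ (l.map D.s).prod = w) →
        ∃ l : List I, l.length = n ∧ (l.map D.s).prod = w⁻¹ := by
    rintro w n ⟨l, hl, hw⟩
    exact ⟨l.reverse, by simpa using hl, hw ▸ D.prod_map_s_reverse id l⟩
  refine congrArg sInf (Set.ext fun n => ⟨fun h => ?_, key w n⟩)
  simpa using key _ n h

/-- Acting by the product of a word, the root attached to a letter of the reversed word becomes
the negative of the root attached to the same letter of the word. -/
theorem prod_map_s_apply_reverse_root (l : List I) (k : ℕ) (hk : k < l.length) :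
    (l.map D.s).prod (((l.reverse.take (l.length - 1 - k)).map D.s).prod (D.α l[k])) =
      -((l.take k).map D.s).prod (D.α l[k]) := by
  have htake : l.reverse.take (l.length - 1 - k) = (l.drop (k + 1)).reverse := by
    rw [List.take_reverse]
    congr 2
    omega
  have hsplit : (l.map D.s).prod =
      ((l.take k).map D.s).prod * D.s l[k] * ((l.drop (k + 1)).map D.s).prod := by
    conv_lhs => rw [← List.take_append_drop k l, List.drop_eq_getElem_cons hk]
    simp only [List.map_append, List.map_cons, List.prod_append, List.prod_cons, mul_assoc]
  have hrev : ((l.drop (k + 1)).reverse.map D.s).prod = ((l.drop (k + 1)).map D.s).prod⁻¹ :=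
    D.prod_map_s_reverse id _
  rw [htake, hrev, ← LinearEquiv.mul_apply, hsplit, mul_inv_cancel_right, LinearEquiv.mul_apply,
    s_apply_simpleRoot, map_neg]

end BasedRootDatum

/-- Sorting commutes with an order-reversing bijection up to reversal. -/
theorem Finset.sort_map_of_antitone {X Y : Type*} [LinearOrder X] [LinearOrder Y]
    (e : X ↪ Y) (he : Antitone e) (S : Finset X) :
    (S.map e).sort (· ≤ ·) = (S.sort (· ≤ ·)).reverse.map e := by
  refine List.Perm.eq_of_pairwise' (r := (· ≤ ·)) (Finset.pairwise_sort _ _) ?_ ?_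
  · rw [List.pairwise_map, List.pairwise_reverse]
    exact (Finset.pairwise_sort S (· ≤ ·)).imp fun h => he h
  · refine (List.perm_ext_iff_of_nodup (Finset.sort_nodup _ _) ?_).2 fun y => by simp
    exact (List.nodup_reverse.2 (Finset.sort_nodup _ _)).map e.injective

/-- The bijection between the positions of a list and those of its reversal. -/
def List.reverseIndexEquiv {X : Type*} (l : List X) : Fin l.length ≃ Fin l.reverse.length :=
  Fin.revPerm.trans (finCongr l.length_reverse.symm)

theorem List.val_reverseIndexEquiv {X : Type*} (l : List X) (k : Fin l.length) :
    (l.reverseIndexEquiv k : ℕ) = l.length - 1 - k := by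
  simp only [List.reverseIndexEquiv, Equiv.trans_apply, Fin.revPerm_apply, finCongr_apply,
    Fin.val_cast, Fin.val_rev]
  omega

theorem List.get_reverseIndexEquiv {X : Type*} (l : List X) (k : Fin l.length) :
    l.reverse.get (l.reverseIndexEquiv k) = l.get k := by
  simp only [List.get_eq_getElem, List.getElem_reverse, List.val_reverseIndexEquiv]
  congr 1
  omega

theorem List.antitone_reverseIndexEquiv {X : Type*} (l : List X) :
    Antitone l.reverseIndexEquiv := fun a b h => by
  simp only [Fin.le_def, List.val_reverseIndexEquiv] at h ⊢
  omega

/-- `d_{v,u} = (-1)^{ℓ(v)} u(d_{v⁻¹, u⁻¹})`, where `d_{v⁻¹,u⁻¹}` is computed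
from the reversed reduced word, and `u` acts on polynomials through the algebra
endomorphism `U` extending its action on the root space. -/
theorem dPoly_transpose (D : BasedRootDatum I)
    {A : Type} [CommRing A] [Algebra ℚ A] (ι : D.V →ₗ[ℚ] A)
    (v u : D.V ≃ₗ[ℚ] D.V) (hv : v ∈ D.weylGroup) (hu : u ∈ D.weylGroup)
    (U : A →ₐ[ℚ] A) (hU : ∀ x : D.V, U (ι x) = ι (u x))
    (l : List I) (hprod : (l.map D.s).prod = u) (hred : l.length = D.len u) :
    D.dPoly ι l v = (-1 : A) ^ (D.len v) * U (D.dPoly ι l.reverse v⁻¹) := by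
  classical
  have hword (S : Finset (Fin l.length)) :
      (((S.map l.reverseIndexEquiv.toEmbedding).sort (· ≤ ·)).map
        fun k => D.s (l.reverse.get k)).prod =
      ((S.sort (· ≤ ·)).map fun k => D.s (l.get k)).prod⁻¹ := by
    rw [Finset.sort_map_of_antitone _ l.antitone_reverseIndexEquiv, List.map_map,
      ← D.prod_map_s_reverse]
    simp only [Function.comp_def, Equiv.coe_toEmbedding, List.get_reverseIndexEquiv]
  have hroot (k : Fin l.length) :
      U (ι (((l.reverse.take (l.reverseIndexEquiv k : ℕ)).map D.s).prod
        (D.α (l.reverse.get (l.reverseIndexEquiv k))))) =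
      -ι (((l.take (k : ℕ)).map D.s).prod (D.α (l.get k))) := by
    rw [hU, ← hprod, l.get_reverseIndexEquiv, l.val_reverseIndexEquiv, List.get_eq_getElem,
      D.prod_map_s_apply_reverse_root l k k.isLt, map_neg]
  rw [BasedRootDatum.dPoly, BasedRootDatum.dPoly, map_sum, Finset.mul_sum]
  refine Fintype.sum_equiv l.reverseIndexEquiv.finsetCongr _ _ fun S => ?_
  simp only [Equiv.finsetCongr_apply, hword, inv_inj, Finset.card_map, D.len_inv]
  split_ifs with h
  · rw [Finset.prod_map, map_prod]
    simp only [Equiv.coe_toEmbedding, hroot]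
    rw [Finset.prod_neg, ← h.2, ← mul_assoc, ← mul_pow]
    simp
  · simp
end
end
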